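/- arXiv:2407.13380 — 7 statements merged into one kernel-verified Lean document; each statement's English description precedes it below -/
import Mathlib

section
/- Let f : ℝ → ℝ be differentiable, let m₀ ≤ M₀ be real numbers, and let u_L, u_R ∈ [m₀, M₀]. If α > 0 satisfies α ≥ |f'(u)| for all u ∈ [m₀, M₀], then the Lax–Friedrichs intermediate state ũ = ½(u_L + u_R) + (1/(2α))(f(u_L) − f(u_R)) satisfies m₀ ≤ ũ ≤ M₀. -/
theorem llf_intermediate_state_scalar_MP
    (f : ℝ → ℝ) (hf : Differentiable ℝ f)
    (m₀ M₀ uL uR α : ℝ) (hm : m₀ ≤ M₀)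
    (hL : uL ∈ Set.Icc m₀ M₀) (hR : uR ∈ Set.Icc m₀ M₀)
    (hα : 0 < α) (hbound : ∀ u ∈ Set.Icc m₀ M₀, |deriv f u| ≤ α) :
    m₀ ≤ (uL + uR) / 2 + (f uL - f uR) / (2 * α) ∧
      (uL + uR) / 2 + (f uL - f uR) / (2 * α) ≤ M₀ := by
  have hlip : |f uL - f uR| ≤ α * |uL - uR| :=
    (convex_Icc m₀ M₀).norm_image_sub_le_of_norm_deriv_le
      (fun x _ => hf x) hbound hR hL
  have hquot : |(f uL - f uR) / (2 * α)| ≤ |uL - uR| / 2 := by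
    rw [abs_div, abs_of_pos (by positivity : 0 < 2 * α), div_le_iff₀ (by positivity)]
    linarith
  obtain ⟨hL₁, hL₂⟩ := hL
  obtain ⟨hR₁, hR₂⟩ := hR
  obtain ⟨hlow, hupp⟩ := abs_le.mp hquot
  rcases abs_cases (uL - uR) with ⟨h, _⟩ | ⟨h, _⟩ <;> rw [h] at hlow hupp <;>
    constructor <;> linarith
end

section
/- Let U_L, U_R ∈ G and let α > 0 satisfy α ≥ max{|v₁(U_L)| + a(U_L), |v₁(U_R)| + a(U_R)}. Then the intermediate state Ũ = ½(U_L + U_R) + (1/(2α))(F₁(U_L) − F₁(U_R)) belongs to G, i.e. it has positive density ρ(Ũ) > 0 and positive pressure p(Ũ) > 0. -/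
noncomputable section

/-- Perfect-gas pressure of a 2D Euler conservative state `U = (ρ, m₁, m₂, E)`. -/
def eulerPressure (γ : ℝ) (U : Fin 4 → ℝ) : ℝ :=
  (γ - 1) * (U 3 - ((U 1) ^ 2 + (U 2) ^ 2) / (2 * U 0))

/-- x-directional Euler flux. -/
def eulerFlux1 (γ : ℝ) (U : Fin 4 → ℝ) : Fin 4 → ℝ :=
  ![U 1, (U 1) ^ 2 / U 0 + eulerPressure γ U, U 1 * U 2 / U 0,
    (U 3 + eulerPressure γ U) * (U 1 / U 0)]

/-- Sound speed. -/
def soundSpeed (γ : ℝ) (U : Fin 4 → ℝ) : ℝ :=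
  Real.sqrt (γ * eulerPressure γ U / U 0)

/-- Admissible state set: positive density and pressure. -/
def eulerAdmissible (γ : ℝ) : Set (Fin 4 → ℝ) :=
  {U | 0 < U 0 ∧ 0 < eulerPressure γ U}

theorem mem_eulerAdmissible_iff {γ : ℝ} (hγ : 1 < γ) (U : Fin 4 → ℝ) :
    U ∈ eulerAdmissible γ ↔ 0 < U 0 ∧ 0 < 2 * U 0 * U 3 - (U 1 ^ 2 + U 2 ^ 2) := by
  refine and_congr_right fun h0 => ?_
  have key : U 3 - (U 1 ^ 2 + U 2 ^ 2) / (2 * U 0)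
      = (2 * U 0 * U 3 - (U 1 ^ 2 + U 2 ^ 2)) / (2 * U 0) := by
    field_simp
  rw [eulerPressure, mul_pos_iff_of_pos_left (sub_pos.2 hγ), key,
    div_pos_iff_of_pos_right (by positivity)]

theorem eulerAdmissible_add {γ : ℝ} (hγ : 1 < γ) {U V : Fin 4 → ℝ}
    (hU : U ∈ eulerAdmissible γ) (hV : V ∈ eulerAdmissible γ) :
    U + V ∈ eulerAdmissible γ := by
  rw [mem_eulerAdmissible_iff hγ] at *
  obtain ⟨hU0, hU1⟩ := hU
  obtain ⟨hV0, hV1⟩ := hV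
  simp only [Pi.add_apply]
  refine ⟨add_pos hU0 hV0, ?_⟩
  refine pos_of_mul_pos_right (a := U 0 * V 0) ?_ (by positivity)
  have key : U 0 * V 0 * (2 * (U 0 + V 0) * (U 3 + V 3) - ((U 1 + V 1) ^ 2 + (U 2 + V 2) ^ 2))
      = (U 0 + V 0) * (V 0 * (2 * U 0 * U 3 - (U 1 ^ 2 + U 2 ^ 2))
          + U 0 * (2 * V 0 * V 3 - (V 1 ^ 2 + V 2 ^ 2)))
        + (U 0 * V 1 - V 0 * U 1) ^ 2 + (U 0 * V 2 - V 0 * U 2) ^ 2 := by ring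
  rw [key]
  positivity

theorem eulerAdmissible_smul {γ : ℝ} (hγ : 1 < γ) {U : Fin 4 → ℝ}
    (hU : U ∈ eulerAdmissible γ) {c : ℝ} (hc : 0 < c) : c • U ∈ eulerAdmissible γ := by
  rw [mem_eulerAdmissible_iff hγ] at *
  obtain ⟨h0, h1⟩ := hU
  simp only [Pi.smul_apply, smul_eq_mul]
  refine ⟨mul_pos hc h0, ?_⟩
  have key : 2 * (c * U 0) * (c * U 3) - ((c * U 1) ^ 2 + (c * U 2) ^ 2)
      = c ^ 2 * (2 * U 0 * U 3 - (U 1 ^ 2 + U 2 ^ 2)) := by ring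
  rw [key]
  positivity

/-- Lax–Friedrichs splitting: `α U ± F₁(U)` is admissible once `α` dominates the wave speeds. -/
theorem smul_add_smul_eulerFlux1_mem {γ : ℝ} (hγ : 1 < γ) {U : Fin 4 → ℝ}
    (hU : U ∈ eulerAdmissible γ) {α s : ℝ} (hs : s ^ 2 = 1)
    (hα : |U 1 / U 0| + soundSpeed γ U ≤ α) :
    α • U + s • eulerFlux1 γ U ∈ eulerAdmissible γ := by
  obtain ⟨h0, hp⟩ := hU
  rw [mem_eulerAdmissible_iff hγ]
  have hE : U 3 = eulerPressure γ U / (γ - 1) + (U 1 ^ 2 + U 2 ^ 2) / (2 * U 0) := by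
    have : γ - 1 ≠ 0 := (sub_pos.2 hγ).ne'
    rw [eulerPressure]
    field_simp
    ring
  have ha : 0 < γ * eulerPressure γ U / U 0 := by positivity
  have habs : |s * (U 1 / U 0)| = |U 1 / U 0| := by
    rw [abs_mul, (by rwa [← sq_eq_sq₀ (abs_nonneg s) zero_le_one, sq_abs, one_pow] : |s| = 1), one_mul]
  have hc : soundSpeed γ U ≤ α + s * (U 1 / U 0) := by
    linarith [neg_abs_le (s * (U 1 / U 0))]
  have hcpos : 0 < α + s * (U 1 / U 0) := (Real.sqrt_pos.2 ha).trans_le hc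
  have hc2 : γ * eulerPressure γ U / U 0 ≤ (α + s * (U 1 / U 0)) ^ 2 :=
    (Real.sqrt_le_left hcpos.le).1 hc
  simp only [eulerFlux1, Pi.add_apply, Pi.smul_apply, smul_eq_mul, Matrix.cons_val]
  generalize eulerPressure γ U = p at *
  obtain ⟨v, hv⟩ : ∃ v, v = U 1 / U 0 := ⟨_, rfl⟩
  have hm : U 1 = U 0 * v := by rw [hv]; field_simp
  rw [← hv] at hc2 hcpos
  have hρ : α * U 0 + s * U 1 = U 0 * (α + s * v) := by rw [hm]; ring
  refine ⟨hρ ▸ mul_pos h0 hcpos, ?_⟩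
  have hg : 0 < γ - 1 := sub_pos.2 hγ
  have key : 2 * (α * U 0 + s * U 1) * (α * U 3 + s * ((U 3 + p) * (U 1 / U 0)))
      - ((α * U 1 + s * (U 1 ^ 2 / U 0 + p)) ^ 2 + (α * U 2 + s * (U 1 * U 2 / U 0)) ^ 2)
      = 2 * U 0 * p / (γ - 1) * (α + s * v) ^ 2 - s ^ 2 * p ^ 2 := by
    rw [hE, hm]
    field_simp
    ring
  rw [key, hs, one_mul, sub_pos]
  calc p ^ 2 < 2 * U 0 * p / (γ - 1) * (γ * p / U 0) := by
        have : 2 * U 0 * p / (γ - 1) * (γ * p / U 0) = p ^ 2 * (2 * γ / (γ - 1)) := by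
          field_simp
        rw [this]
        refine lt_mul_of_one_lt_right (by positivity) ?_
        rw [one_lt_div hg]
        linarith
    _ ≤ _ := by gcongr

theorem llf_intermediate_state_euler_admissible
    (γ : ℝ) (hγ : 1 < γ) (UL UR : Fin 4 → ℝ)
    (hL : UL ∈ eulerAdmissible γ) (hR : UR ∈ eulerAdmissible γ)
    (α : ℝ) (hα : 0 < α)
    (hαL : |UL 1 / UL 0| + soundSpeed γ UL ≤ α)
    (hαR : |UR 1 / UR 0| + soundSpeed γ UR ≤ α) :
    (1 / 2 : ℝ) • (UL + UR) + (1 / (2 * α)) • (eulerFlux1 γ UL - eulerFlux1 γ UR)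
      ∈ eulerAdmissible γ := by
  have hWL := smul_add_smul_eulerFlux1_mem hγ hL (s := 1) (by norm_num) hαL
  have hWR := smul_add_smul_eulerFlux1_mem hγ hR (s := -1) (by norm_num) hαR
  convert eulerAdmissible_smul hγ (eulerAdmissible_add hγ hWL hWR)
    (show 0 < 1 / (2 * α) by positivity) using 1
  ext i
  simp only [Pi.add_apply, Pi.sub_apply, Pi.smul_apply, smul_eq_mul]
  field_simp
  ring
end
end

section
/- Let U ∈ G and let α > 0 satisfy α ≥ |v₁(U)| + a(U). Then both states U + (1/α)F₁(U) and U − (1/α)F₁(U) belong to G, i.e. each has positive density and positive pressure. -/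
noncomputable section

/-- The pressure of a state shifted along its flux. -/
theorem eulerPressure_add_smul_flux (γ s : ℝ) (hγ : γ ≠ 1) (U : Fin 4 → ℝ) (hρ : U 0 ≠ 0)
    (hc : 1 + s * (U 1 / U 0) ≠ 0) :
    eulerPressure γ (U + s • eulerFlux1 γ U) =
      eulerPressure γ U / (2 * U 0 * (1 + s * (U 1 / U 0))) *
        (2 * U 0 * (1 + s * (U 1 / U 0)) ^ 2 - (γ - 1) * s ^ 2 * eulerPressure γ U) := by
  have hg : γ - 1 ≠ 0 := sub_ne_zero.mpr hγ
  obtain ⟨p, hp⟩ : ∃ p, p = eulerPressure γ U := ⟨_, rfl⟩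
  obtain ⟨v, hv⟩ : ∃ v, v = U 1 / U 0 := ⟨_, rfl⟩
  have hm : U 1 = U 0 * v := by rw [hv]; field_simp
  have hE : U 3 = p / (γ - 1) + ((U 1) ^ 2 + (U 2) ^ 2) / (2 * U 0) := by
    rw [hp, eulerPressure]; field_simp; ring
  rw [← hv] at hc
  rw [← hp, ← hv, eulerPressure]
  simp only [eulerFlux1, ← hp, ← hv, Pi.add_apply, Pi.smul_apply, smul_eq_mul, Matrix.cons_val]
  rw [hE, hm, show U 0 + s * (U 0 * v) = U 0 * (1 + s * v) by ring]
  generalize hcv : 1 + s * v = c at hc ⊢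
  field_simp
  rw [← hcv]
  ring

/-- A shift along the flux stays admissible as long as it is at most the acoustic step. -/
theorem add_smul_flux_mem_eulerAdmissible {γ s : ℝ} (hγ : 1 < γ) {U : Fin 4 → ℝ}
    (hU : U ∈ eulerAdmissible γ) (hs : s ≠ 0)
    (hc : |s| * soundSpeed γ U ≤ 1 + s * (U 1 / U 0)) :
    U + s • eulerFlux1 γ U ∈ eulerAdmissible γ := by
  obtain ⟨hρ, hp⟩ := hU
  have ha : 0 < soundSpeed γ U := Real.sqrt_pos.mpr (by positivity)
  have ha2 : soundSpeed γ U ^ 2 * U 0 = γ * eulerPressure γ U := by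
    rw [soundSpeed, Real.sq_sqrt (by positivity)]
    field_simp
  have hc0 : 0 < 1 + s * (U 1 / U 0) := lt_of_lt_of_le (by positivity) hc
  have hc2 : s ^ 2 * (γ * eulerPressure γ U) ≤ U 0 * (1 + s * (U 1 / U 0)) ^ 2 := by
    have h := mul_le_mul_of_nonneg_left (pow_le_pow_left₀ (by positivity) hc 2) hρ.le
    rw [mul_pow, sq_abs] at h
    rw [← ha2]
    linarith
  refine ⟨?_, ?_⟩
  · have h : (U + s • eulerFlux1 γ U) 0 = U 0 * (1 + s * (U 1 / U 0)) := by
      simp only [eulerFlux1, Pi.add_apply, Pi.smul_apply, smul_eq_mul, Matrix.cons_val]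
      field_simp
    rw [h]
    positivity
  · rw [eulerPressure_add_smul_flux γ s hγ.ne' U hρ.ne' hc0.ne']
    refine mul_pos (by positivity) ?_
    have h1 : 0 < s ^ 2 * eulerPressure γ U := by positivity
    nlinarith [mul_pos (by linarith : 0 < γ) h1]

theorem shifted_states_admissible
    (γ : ℝ) (hγ : 1 < γ) (U : Fin 4 → ℝ)
    (hU : U ∈ eulerAdmissible γ)
    (α : ℝ) (hα : 0 < α)
    (hαU : |U 1 / U 0| + soundSpeed γ U ≤ α) :
    U + (1 / α) • eulerFlux1 γ U ∈ eulerAdmissible γ ∧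
      U - (1 / α) • eulerFlux1 γ U ∈ eulerAdmissible γ := by
  have habs := abs_le.mp (le_refl |U 1 / U 0|)
  have hdiv : soundSpeed γ U / α + |U 1 / U 0| / α ≤ 1 := by
    rw [← add_div, div_le_one hα]
    linarith
  have h1 : U 1 / U 0 / α ≤ |U 1 / U 0| / α := by gcongr; exact habs.2
  have h2 : -|U 1 / U 0| / α ≤ U 1 / U 0 / α := by gcongr; exact habs.1
  rw [neg_div] at h2
  constructor
  · refine add_smul_flux_mem_eulerAdmissible hγ hU (by positivity) ?_
    rw [abs_of_pos (by positivity), one_div_mul_eq_div, one_div_mul_eq_div]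
    linarith
  · rw [sub_eq_add_neg, ← neg_smul]
    refine add_smul_flux_mem_eulerAdmissible hγ hU (neg_ne_zero.mpr (by positivity)) ?_
    rw [abs_neg, abs_of_pos (by positivity), neg_mul, one_div_mul_eq_div, one_div_mul_eq_div]
    linarith
end
end

section
/- The admissible state set G = {(ρ, m₁, m₂, E) ∈ ℝ⁴ : ρ > 0 and (γ−1)(E − (m₁²+m₂²)/(2ρ)) > 0} of the 2D compressible Euler equations is a convex subset of ℝ⁴. -/
noncomputable section

/-- Joint convexity of `(m, ρ) ↦ m ^ 2 / ρ`, in homogeneous form. -/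
theorem add_sq_div_add_le {r s : ℝ} (x y : ℝ) (hr : 0 < r) (hs : 0 < s) :
    (x + y) ^ 2 / (r + s) ≤ x ^ 2 / r + y ^ 2 / s := by
  rw [div_add_div _ _ hr.ne' hs.ne', div_le_div_iff₀ (by positivity) (by positivity)]
  nlinarith [sq_nonneg (x * s - y * r)]

theorem euler_admissible_set_convex (γ : ℝ) (hγ : 1 < γ) :
    Convex ℝ {U : Fin 4 → ℝ | 0 < U 0 ∧
      0 < (γ - 1) * (U 3 - ((U 1) ^ 2 + (U 2) ^ 2) / (2 * U 0))} := by
  have hγ' : 0 < γ - 1 := sub_pos.mpr hγ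
  rw [convex_iff_forall_pos]
  rintro U ⟨hU, hpU⟩ V ⟨hV, hpV⟩ a b ha hb -
  have hpU' := mul_pos ha (pos_of_mul_pos_right hpU hγ'.le)
  have hpV' := mul_pos hb (pos_of_mul_pos_right hpV hγ'.le)
  have hscale : ∀ c m ρ : ℝ, 0 < c → 0 < ρ →
      (c * m) ^ 2 / (2 * (c * ρ)) = c * (m ^ 2 / (2 * ρ)) := by
    intro c m ρ hc hρ
    field_simp
  have hsum : ∀ i, (a * U i + b * V i) ^ 2 / (2 * (a * U 0 + b * V 0)) ≤
      a * ((U i) ^ 2 / (2 * U 0)) + b * ((V i) ^ 2 / (2 * V 0)) := by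
    intro i
    rw [← hscale a _ _ ha hU, ← hscale b _ _ hb hV, mul_add]
    exact add_sq_div_add_le _ _ (by positivity) (by positivity)
  refine ⟨?_, mul_pos hγ' ?_⟩ <;> simp only [Pi.add_apply, Pi.smul_apply, smul_eq_mul]
  · positivity
  · rw [add_div] at hpU' hpV' ⊢
    linarith [hsum 1, hsum 2]
end
end

section
/- Let f₁, f₂ : ℝ → ℝ be differentiable, m₀ ≤ M₀, and let ū_C, ū_W, ū_E, ū_S, ū_N ∈ [m₀, M₀] be five cell values. Let α_W, α_E > 0 satisfy α_W, α_E ≥ |f₁'(u)| for all u ∈ [m₀, M₀], and α_S, α_N > 0 satisfy α_S, α_N ≥ |f₂'(u)| for all u ∈ [m₀, M₀]. Let Δt, Δx, Δy > 0 with Δt ≤ ½ min{Δx/(α_W + α_E), Δy/(α_S + α_N)}, and set μ₁ = Δt/Δx, μ₂ = Δt/Δy. Then the first-order local Lax–Friedrichs update ū' = ū_C − μ₁(f̂_E − f̂_W) − μ₂(f̂_N − f̂_S), where f̂_E = ½(f₁(ū_C)+f₁(ū_E)) − (α_E/2)(ū_E − ū_C), f̂_W = ½(f₁(ū_W)+f₁(ū_C))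 − (α_W/2)(ū_C − ū_W), f̂_N = ½(f₂(ū_C)+f₂(ū_N)) − (α_N/2)(ū_N − ū_C), f̂_S = ½(f₂(ū_S)+f₂(ū_C)) − (α_S/2)(ū_C − ū_S), satisfies m₀ ≤ ū' ≤ M₀. -/
theorem abs_sub_le_of_abs_deriv_le {f : ℝ → ℝ} (hf : Differentiable ℝ f) {m M α : ℝ}
    (hb : ∀ u ∈ Set.Icc m M, |deriv f u| ≤ α) {a b : ℝ}
    (ha : a ∈ Set.Icc m M) (hb' : b ∈ Set.Icc m M) :
    |f b - f a| ≤ α * |b - a| :=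
  (convex_Icc m M).norm_image_sub_le_of_norm_deriv_le (fun x _ => hf x) hb ha hb'

theorem viscosity_add_mem_Icc {m M α a b d : ℝ} (hα : 0 ≤ α)
    (ha : a ∈ Set.Icc m M) (hb : b ∈ Set.Icc m M) (hd : |d| ≤ α * |b - a|) :
    (α * (b - a) + d) / 2 ∈ Set.Icc (α * (m - a)) (α * (M - a)) := by
  obtain ⟨ham, haM⟩ := ha
  obtain ⟨hbm, hbM⟩ := hb
  obtain ⟨hd₁, hd₂⟩ := abs_le.mp hd
  have h₁ : α * (b - a) ≤ α * (M - a) := by gcongr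
  have h₂ : α * (m - a) ≤ α * (b - a) := by gcongr
  have h₃ : 0 ≤ α * (M - a) := mul_nonneg hα (by linarith)
  have h₄ : 0 ≤ α * (a - m) := mul_nonneg hα (by linarith)
  rcases abs_cases (b - a) with ⟨h, -⟩ | ⟨h, -⟩ <;> rw [h] at hd₁ hd₂ <;>
    constructor <;> linarith

/-- The contribution of one space direction to the local Lax–Friedrichs update, under the
one-directional CFL condition. -/
theorem llf_increment_mem_Icc {f : ℝ → ℝ} (hf : Differentiable ℝ f) {m M c l r αl αr μ : ℝ}
    (hc : c ∈ Set.Icc m M) (hl : l ∈ Set.Icc m M) (hr : r ∈ Set.Icc m M)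
    (hαl : 0 ≤ αl) (hαr : 0 ≤ αr)
    (hbl : ∀ u ∈ Set.Icc m M, |deriv f u| ≤ αl) (hbr : ∀ u ∈ Set.Icc m M, |deriv f u| ≤ αr)
    (hμ : 0 ≤ μ) (hcfl : μ * (αl + αr) ≤ 1 / 2) :
    μ * (((f c + f r) / 2 - αr / 2 * (r - c)) - ((f l + f c) / 2 - αl / 2 * (c - l))) ∈
      Set.Icc ((c - M) / 2) ((c - m) / 2) := by
  obtain ⟨hr₁, hr₂⟩ := viscosity_add_mem_Icc (d := -(f r - f c)) hαr hc hr
    (by rw [abs_neg]; exact abs_sub_le_of_abs_deriv_le hf hbr hc hr)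
  obtain ⟨hl₁, hl₂⟩ := viscosity_add_mem_Icc hαl hc hl (abs_sub_le_of_abs_deriv_le hf hbl hc hl)
  have hM := mul_le_mul_of_nonneg_right hcfl (sub_nonneg.mpr hc.2)
  have hm := mul_le_mul_of_nonneg_right hcfl (sub_nonneg.mpr hc.1)
  have h₁ := mul_le_mul_of_nonneg_left (add_le_add hr₁ hl₁) hμ
  have h₂ := mul_le_mul_of_nonneg_left (add_le_add hr₂ hl₂) hμ
  constructor <;> linarith

theorem div_mul_le_half_of_le {t h s : ℝ} (hh : 0 < h) (hs : 0 < s)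
    (hle : t ≤ 1 / 2 * (h / s)) : t / h * s ≤ 1 / 2 := by
  rw [← mul_div_assoc, le_div_iff₀ hs] at hle
  rwa [div_mul_eq_mul_div, div_le_iff₀ hh]

theorem llf_scheme_2d_scalar_MP
    (f₁ f₂ : ℝ → ℝ) (hf₁ : Differentiable ℝ f₁) (hf₂ : Differentiable ℝ f₂)
    (m₀ M₀ : ℝ) (hm : m₀ ≤ M₀)
    (uC uW uE uS uN : ℝ)
    (hC : uC ∈ Set.Icc m₀ M₀) (hW : uW ∈ Set.Icc m₀ M₀) (hE : uE ∈ Set.Icc m₀ M₀)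
    (hS : uS ∈ Set.Icc m₀ M₀) (hN : uN ∈ Set.Icc m₀ M₀)
    (αW αE αS αN : ℝ) (hαW : 0 < αW) (hαE : 0 < αE) (hαS : 0 < αS) (hαN : 0 < αN)
    (hbW : ∀ u ∈ Set.Icc m₀ M₀, |deriv f₁ u| ≤ αW)
    (hbE : ∀ u ∈ Set.Icc m₀ M₀, |deriv f₁ u| ≤ αE)
    (hbS : ∀ u ∈ Set.Icc m₀ M₀, |deriv f₂ u| ≤ αS)
    (hbN : ∀ u ∈ Set.Icc m₀ M₀, |deriv f₂ u| ≤ αN)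
    (Δt Δx Δy : ℝ) (hΔt : 0 < Δt) (hΔx : 0 < Δx) (hΔy : 0 < Δy)
    (hcfl : Δt ≤ (1 / 2) * min (Δx / (αW + αE)) (Δy / (αS + αN))) :
    let μ₁ := Δt / Δx
    let μ₂ := Δt / Δy
    let fE := (f₁ uC + f₁ uE) / 2 - αE / 2 * (uE - uC)
    let fW := (f₁ uW + f₁ uC) / 2 - αW / 2 * (uC - uW)
    let fN := (f₂ uC + f₂ uN) / 2 - αN / 2 * (uN - uC)
    let fS := (f₂ uS + f₂ uC) / 2 - αS / 2 * (uC - uS)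
    uC - μ₁ * (fE - fW) - μ₂ * (fN - fS) ∈ Set.Icc m₀ M₀ := by
  intro μ₁ μ₂ fE fW fN fS
  have hx : μ₁ * (αW + αE) ≤ 1 / 2 := div_mul_le_half_of_le hΔx (by positivity)
    (hcfl.trans (by gcongr; exact min_le_left _ _))
  have hy : μ₂ * (αS + αN) ≤ 1 / 2 := div_mul_le_half_of_le hΔy (by positivity)
    (hcfl.trans (by gcongr; exact min_le_right _ _))
  obtain ⟨hx₁, hx₂⟩ : μ₁ * (fE - fW) ∈ Set.Icc ((uC - M₀) / 2) ((uC - m₀) / 2) :=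
    llf_increment_mem_Icc hf₁ hC hW hE hαW.le hαE.le hbW hbE (by positivity) hx
  obtain ⟨hy₁, hy₂⟩ : μ₂ * (fN - fS) ∈ Set.Icc ((uC - M₀) / 2) ((uC - m₀) / 2) :=
    llf_increment_mem_Icc hf₂ hC hS hN hαS.le hαN.le hbS hbN (by positivity) hy
  constructor <;> linarith
end

section
/- Let m₀ ≤ M₀, let u^L ∈ [m₀, M₀], let u^H ∈ ℝ with u^H ≠ u^L, and define θ = min{ |(u^L − m₀)/(u^L − u^H)|, |(M₀ − u^L)/(u^H − u^L)|, 1 }. Then θ ∈ [0, 1] and the limited value u^Lim = θ·u^H + (1 − θ)·u^L satisfies m₀ ≤ u^Lim ≤ M₀. -/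
theorem scaling_limiter_scalar_MP
    (m₀ M₀ uL uH : ℝ) (hm : m₀ ≤ M₀)
    (hL : uL ∈ Set.Icc m₀ M₀) (hne : uH ≠ uL) :
    let θ := min (min |(uL - m₀) / (uL - uH)| |(M₀ - uL) / (uH - uL)|) 1
    θ ∈ Set.Icc (0 : ℝ) 1 ∧ θ * uH + (1 - θ) * uL ∈ Set.Icc m₀ M₀ := by
  intro θ
  obtain ⟨hmL, hLM⟩ := hL
  have hpos : 0 < |uH - uL| := abs_pos.mpr (sub_ne_zero.mpr hne)
  have hθ : 0 ≤ θ := le_min (le_min (abs_nonneg _) (abs_nonneg _)) zero_le_one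
  have hlow : θ * |uH - uL| ≤ uL - m₀ := by
    rw [← le_div_iff₀ hpos]
    refine (min_le_left _ _).trans ((min_le_left _ _).trans_eq ?_)
    rw [abs_div, abs_of_nonneg (sub_nonneg.mpr hmL), abs_sub_comm uL uH]
  have hupp : θ * |uH - uL| ≤ M₀ - uL := by
    rw [← le_div_iff₀ hpos]
    refine (min_le_left _ _).trans ((min_le_right _ _).trans_eq ?_)
    rw [abs_div, abs_of_nonneg (sub_nonneg.mpr hLM)]
  have hneg := mul_le_mul_of_nonneg_left (neg_abs_le (uH - uL)) hθ
  have hle := mul_le_mul_of_nonneg_left (le_abs_self (uH - uL)) hθ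
  exact ⟨⟨hθ, min_le_right _ _⟩, by linarith, by linarith⟩
end

section
/- Let ε ∈ ℝ and let U*, U^L ∈ ℝ⁴ be 2D Euler conservative states with ρ(U*) > 0, ρ(U^L) > 0 and p(U^L) > ε. Define θ** = min{(p(U^L) − ε)/(p(U^L) − p(U*)), 1} if p(U*) < p(U^L), and θ** = 1 otherwise. Then θ** ∈ [0, 1] and the limited state U^Lim = θ**·U* + (1 − θ**)·U^L satisfies ρ(U^Lim) > 0 and p(U^Lim) ≥ ε. -/
noncomputable section

/-- The perfect-gas pressure is concave on the states of positive density. -/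
theorem eulerPressure_concave {γ : ℝ} (hγ : 1 ≤ γ) :
    ConcaveOn ℝ {U : Fin 4 → ℝ | 0 < U 0} (eulerPressure γ) := by
  have hconv : Convex ℝ {U : Fin 4 → ℝ | 0 < U 0} :=
    convex_halfSpace_gt (LinearMap.proj (R := ℝ) (φ := fun _ : Fin 4 => ℝ) 0).isLinear 0
  refine ⟨hconv, fun U hU V hV a b ha hb hab => ?_⟩
  have hW : 0 < a * U 0 + b * V 0 := hconv hU hV ha hb hab
  rw [Set.mem_ofPred_eq] at hU hV
  have jensen (x y : ℝ) : (a * x + b * y) ^ 2 / (a * U 0 + b * V 0) ≤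
      a * (x ^ 2 / U 0) + b * (y ^ 2 / V 0) := by
    have hgap : a * (x ^ 2 / U 0) + b * (y ^ 2 / V 0)
        - (a * x + b * y) ^ 2 / (a * U 0 + b * V 0)
        = a * b * (x * V 0 - y * U 0) ^ 2 / (U 0 * V 0 * (a * U 0 + b * V 0)) := by
      field_simp
      ring
    have : 0 ≤ a * b * (x * V 0 - y * U 0) ^ 2 / (U 0 * V 0 * (a * U 0 + b * V 0)) := by
      positivity
    linarith
  have hsplit (x y r : ℝ) : (x ^ 2 + y ^ 2) / (2 * r) = (x ^ 2 / r + y ^ 2 / r) / 2 := by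
    rw [← add_div, div_div, mul_comm r]
  simp only [eulerPressure, Pi.add_apply, Pi.smul_apply, smul_eq_mul, hsplit]
  have h := mul_le_mul_of_nonneg_left
    (add_le_add (jensen (U 1) (V 1)) (jensen (U 2) (V 2))) (sub_nonneg.2 hγ)
  linarith

theorem scaling_limiter_pressure_positivity
    (γ : ℝ) (hγ : 1 < γ) (ε : ℝ) (Ustar UL : Fin 4 → ℝ)
    (hρstar : 0 < Ustar 0) (hρL : 0 < UL 0)
    (hpL : ε < eulerPressure γ UL) :
    let θ := if eulerPressure γ Ustar < eulerPressure γ UL then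
        min ((eulerPressure γ UL - ε) / (eulerPressure γ UL - eulerPressure γ Ustar)) 1
      else 1
    let ULim := θ • Ustar + (1 - θ) • UL
    θ ∈ Set.Icc (0 : ℝ) 1 ∧ 0 < ULim 0 ∧ ε ≤ eulerPressure γ ULim := by
  intro θ ULim
  have hθ : θ ∈ Set.Icc (0 : ℝ) 1 := by
    simp only [θ]
    split_ifs with h
    · exact ⟨le_min (div_nonneg (sub_pos.2 hpL).le (sub_pos.2 h).le) zero_le_one,
        min_le_right _ _⟩
    · exact ⟨zero_le_one, le_rfl⟩
  have hconc := eulerPressure_concave hγ.le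
  have hsum : θ + (1 - θ) = 1 := by ring
  refine ⟨hθ, hconc.1 hρstar hρL hθ.1 (sub_nonneg.2 hθ.2) hsum, ?_⟩
  refine le_trans ?_ (hconc.2 hρstar hρL hθ.1 (sub_nonneg.2 hθ.2) hsum)
  simp only [smul_eq_mul]
  by_cases h : eulerPressure γ Ustar < eulerPressure γ UL
  · have hle : θ ≤ (eulerPressure γ UL - ε) /
        (eulerPressure γ UL - eulerPressure γ Ustar) := by
      simp only [θ, if_pos h]
      exact min_le_left _ _
    rw [le_div_iff₀ (sub_pos.2 h)] at hle
    linarith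
  · have hone : θ = 1 := if_neg h
    rw [hone]
    linarith
end
end
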